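/- Let M ≥ 1 be an integer, let Υ_ν, Υ_e, Υ_u, Υ_d be M×M complex matrices with a_u := tr(Υ_ν†Υ_ν) + 3·tr(Υ_u†Υ_u) > 0 and a_d := tr(Υ_e†Υ_e) + 3·tr(Υ_d†Υ_d) > 0, and let ω_11, ω_12, ω_13, ω_23 be real numbers with ω_12 ≠ 0 satisfying all of: (M/2)·ω_11·a_u = ω_12·tr(Υ_ν†Υ_ν), (M/2)·ω_11·a_d = ω_12·tr(Υ_e†Υ_e), (M/2)·ω_13·a_u = ω_12·tr(Υ_u†Υ_u), (M/2)·ω_13·a_d = ω_12·tr(Υ_d†Υ_d), 1_M = (1/a_u)·Υ_νᵗ(Υ_ν*)ᵗ + (1/a_d)·Υ_eᵗ(Υ_e*)ᵗ, and (ω_23/ω_12)·1_M = (1/a_u)·Υ_u†Υ_u + (1/a_d)·Υ_d†Υ_d. If in addition ω_12 = 1/2 and ω_23 = 1/2, then M = 1/2 as a rational number; hence no such integer M ≥ 1 and matrices exist. -/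

import Mathlib

open Matrix

open scoped ComplexOrder in
theorem trace_conjTranspose_mul_self_re_nonneg {n : ℕ} (A : Matrix (Fin n) (Fin n) ℂ) :
    0 ≤ (Aᴴ * A).trace.re :=
  (Complex.le_def.1 (Matrix.posSemidef_conjTranspose_mul_self A).trace_nonneg).1

/-- Joint inconsistency of the supersymmetry constraints of the noncommutative MSSM:
for an integer `M ≥ 1` and `M×M` complex Yukawa matrices `Υν, Υe, Υu, Υd` with
`a_u = tr(Υν† Υν) + 3 tr(Υu† Υu) > 0`, `a_d = tr(Υe† Υe) + 3 tr(Υd† Υd) > 0`, if real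
coefficients `ω₁₁, ω₁₂, ω₁₃, ω₂₃` with `ω₁₂ ≠ 0` satisfy the four trace relations, the
two matrix identities, and moreover `ω₁₂ = 1/2` and `ω₂₃ = 1/2`, then `M = 1/2` as a
rational number; hence no such integer `M ≥ 1` and matrices exist. -/
theorem stmt_15 (M : ℕ) (hM : 1 ≤ M)
    (Υν Υe Υu Υd : Matrix (Fin M) (Fin M) ℂ)
    (a_u a_d : ℝ)
    (ha_u : (a_u : ℂ) = (Υνᴴ * Υν).trace + 3 * (Υuᴴ * Υu).trace)
    (ha_d : (a_d : ℂ) = (Υeᴴ * Υe).trace + 3 * (Υdᴴ * Υd).trace)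
    (ha_u_pos : 0 < a_u) (ha_d_pos : 0 < a_d)
    (ω11 ω12 ω13 ω23 : ℝ) (hω12 : ω12 ≠ 0)
    (h1 : ((M : ℂ) / 2) * (ω11 : ℂ) * (a_u : ℂ) = (ω12 : ℂ) * (Υνᴴ * Υν).trace)
    (h2 : ((M : ℂ) / 2) * (ω11 : ℂ) * (a_d : ℂ) = (ω12 : ℂ) * (Υeᴴ * Υe).trace)
    (h3 : ((M : ℂ) / 2) * (ω13 : ℂ) * (a_u : ℂ) = (ω12 : ℂ) * (Υuᴴ * Υu).trace)
    (h4 : ((M : ℂ) / 2) * (ω13 : ℂ) * (a_d : ℂ) = (ω12 : ℂ) * (Υdᴴ * Υd).trace)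
    (h5 : (1 : Matrix (Fin M) (Fin M) ℂ) =
      (1 / (a_u : ℂ)) • (Υνᵀ * (Υν.map (starRingEnd ℂ))ᵀ) +
      (1 / (a_d : ℂ)) • (Υeᵀ * (Υe.map (starRingEnd ℂ))ᵀ))
    (h6 : ((ω23 / ω12 : ℝ) : ℂ) • (1 : Matrix (Fin M) (Fin M) ℂ) =
      (1 / (a_u : ℂ)) • (Υuᴴ * Υu) + (1 / (a_d : ℂ)) • (Υdᴴ * Υd))
    (h7 : ω12 = 1 / 2) (h8 : ω23 = 1 / 2) :
    (M : ℚ) = 1 / 2 := by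
  exfalso
  -- the traces of `Υ† Υ` have nonnegative real part
  have hν : 0 ≤ (Υνᴴ * Υν).trace.re :=
    trace_conjTranspose_mul_self_re_nonneg Υν
  have he : 0 ≤ (Υeᴴ * Υe).trace.re :=
    trace_conjTranspose_mul_self_re_nonneg Υe
  -- take the trace of the quark matrix identity
  have ht := congrArg Matrix.trace h6
  have hr : ω23 / ω12 = 1 := by rw [h7, h8]; norm_num
  rw [hr, Matrix.trace_smul, Matrix.trace_add, Matrix.trace_smul, Matrix.trace_smul,
    Matrix.trace_one, Fintype.card_fin] at ht
  have hau := congrArg Complex.re ha_u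
  have had := congrArg Complex.re ha_d
  have hre := congrArg Complex.re ht
  have e1 : (1 / (a_u : ℂ)) = ((1 / a_u : ℝ) : ℂ) := by push_cast; rfl
  have e2 : (1 / (a_d : ℂ)) = ((1 / a_d : ℝ) : ℂ) := by push_cast; rfl
  rw [e1, e2] at hre
  simp only [smul_eq_mul, Complex.add_re, Complex.re_ofReal_mul, Complex.natCast_re, one_mul,
    Complex.ofReal_re] at hre hau had
  have h3re : ∀ z : ℂ, (3 * z).re = 3 * z.re := fun z => by simp
  rw [h3re] at hau had
  have hu : 1 / a_u * (Υuᴴ * Υu).trace.re ≤ 1 / 3 := by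
    rw [one_div_mul_eq_div, div_le_iff₀ ha_u_pos]; linarith
  have hd : 1 / a_d * (Υdᴴ * Υd).trace.re ≤ 1 / 3 := by
    rw [one_div_mul_eq_div, div_le_iff₀ ha_d_pos]; linarith
  have hM' : (1 : ℝ) ≤ M := by exact_mod_cast hM
  linarith
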